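/- Fix bus voltages V : Fin n → ℂ, a branch index k, and a bus index i. Then the function t ↦ S_bus(τ, Function.update θ k t)_i has derivative at θ_k equal to V_i·( -Complex.I·conj(Y_ft,k)·(C_f)_{k,i}·conj((C_t·V)_k) + Complex.I·conj(Y_tf,k)·(C_t)_{k,i}·conj((C_f·V)_k) ). That is, G_θ^s = [V]( C_fᵀ[C_t V*][-jY_ft*] + C_tᵀ[C_f V*][jY_tf*] ). -/

import Mathlib

open Matrix

noncomputable section

/-- A real matrix viewed as a complex matrix via coercion. -/
def cmat {m n : ℕ} (A : Matrix (Fin m) (Fin n) ℝ) : Matrix (Fin m) (Fin n) ℂ :=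
  A.map Complex.ofReal

/-- Y_ff,l(τ,θ) = (y_s,l + i·b_c,l/2)/τ_l². -/
def Yff {m : ℕ} (ys : Fin m → ℂ) (bc : Fin m → ℝ) (τ : Fin m → ℝ) (l : Fin m) : ℂ :=
  (ys l + Complex.I * (bc l : ℂ) / 2) / (τ l : ℂ) ^ 2

/-- Y_ft,l(τ,θ) = -y_s,l·e^{iθ_l}/τ_l. -/
def Yft {m : ℕ} (ys : Fin m → ℂ) (τ θ : Fin m → ℝ) (l : Fin m) : ℂ :=
  -ys l * Complex.exp (Complex.I * (θ l : ℂ)) / (τ l : ℂ)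

/-- Y_tf,l(τ,θ) = -y_s,l·e^{-iθ_l}/τ_l. -/
def Ytf {m : ℕ} (ys : Fin m → ℂ) (τ θ : Fin m → ℝ) (l : Fin m) : ℂ :=
  -ys l * Complex.exp (-(Complex.I * (θ l : ℂ))) / (τ l : ℂ)

/-- Y_tt,l = y_s,l + i·b_c,l/2. -/
def Ytt {m : ℕ} (ys : Fin m → ℂ) (bc : Fin m → ℝ) (l : Fin m) : ℂ :=
  ys l + Complex.I * (bc l : ℂ) / 2

/-- The bus admittance matrix
Y_bus = C_fᵀ[Y_ff]C_f + C_fᵀ[Y_ft]C_t + C_tᵀ[Y_tf]C_f + C_tᵀ[Y_tt]C_t + [Y_sh]. -/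
def Ybus {m n : ℕ} (Cf Ct : Matrix (Fin m) (Fin n) ℝ) (ys : Fin m → ℂ) (bc : Fin m → ℝ)
    (Ysh : Fin n → ℂ) (τ θ : Fin m → ℝ) : Matrix (Fin n) (Fin n) ℂ :=
  (cmat Cf)ᵀ * diagonal (Yff ys bc τ) * cmat Cf
    + (cmat Cf)ᵀ * diagonal (Yft ys τ θ) * cmat Ct
    + (cmat Ct)ᵀ * diagonal (Ytf ys τ θ) * cmat Cf
    + (cmat Ct)ᵀ * diagonal (Ytt ys bc) * cmat Ct
    + diagonal Ysh

/-- The bus power injection vector S_bus = [V](Y_bus V)*. -/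
def Sbus {m n : ℕ} (Cf Ct : Matrix (Fin m) (Fin n) ℝ) (ys : Fin m → ℂ) (bc : Fin m → ℝ)
    (Ysh : Fin n → ℂ) (V : Fin n → ℂ) (τ θ : Fin m → ℝ) (i : Fin n) : ℂ :=
  V i * (starRingEnd ℂ) ((Ybus Cf Ct ys bc Ysh τ θ).mulVec V i)

theorem transpose_mul_diagonal_mul_mulVec {m n p R : Type*} [Fintype m] [Fintype p]
    [DecidableEq m] [CommSemiring R] (A : Matrix m n R) (B : Matrix m p R) (d : m → R)
    (v : p → R) (i : n) :
    (Aᵀ * diagonal d * B).mulVec v i = ∑ l, A l i * d l * B.mulVec v l := by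
  rw [← mulVec_mulVec]
  simp [mulVec, dotProduct, mul_diagonal]

theorem hasDerivAt_sum_mul_mul_single {ι : Type*} [Fintype ι] [DecidableEq ι] {f : ℝ → ι → ℂ}
    {k : ι} {f' : ℂ} {x : ℝ} (hf : HasDerivAt f (Pi.single k f') x) (a b : ι → ℂ) :
    HasDerivAt (fun t => ∑ l, a l * f t l * b l) (a k * f' * b k) x := by
  have h := HasDerivAt.fun_sum (u := Finset.univ) fun l _ =>
    ((hasDerivAt_pi.1 hf l).const_mul (a l)).mul_const (b l)
  simpa [Pi.single_apply] using h

theorem hasDerivAt_comp_update {ι : Type*} [Fintype ι] [DecidableEq ι] {g : ι → ℝ → ℂ}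
    {k : ι} {g' : ℂ} {θ : ι → ℝ} (hg : HasDerivAt (g k) g' (θ k)) :
    HasDerivAt (fun t l => g l (Function.update θ k t l)) (Pi.single k g') (θ k) := by
  refine hasDerivAt_pi.2 fun l => ?_
  obtain rfl | hl := eq_or_ne l k
  · simpa using hg
  · simpa [hl] using hasDerivAt_const (θ k) (g l (θ l))

theorem hasDerivAt_Yft_update {m : ℕ} (ys : Fin m → ℂ) (τ θ : Fin m → ℝ) (k : Fin m) :
    HasDerivAt (fun t => Yft ys τ (Function.update θ k t))
      (Pi.single k (Complex.I * Yft ys τ θ k)) (θ k) := by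
  refine hasDerivAt_comp_update (g := fun l s =>
    -ys l * Complex.exp (Complex.I * (s : ℂ)) / (τ l : ℂ)) ?_
  have h := ((((Complex.ofRealCLM.hasDerivAt (x := θ k)).const_mul Complex.I).cexp).const_mul
    (-ys k)).div_const (τ k : ℂ)
  refine h.congr_deriv ?_
  simp only [Yft, Complex.ofRealCLM_apply, Complex.ofReal_one]
  ring

theorem hasDerivAt_Ytf_update {m : ℕ} (ys : Fin m → ℂ) (τ θ : Fin m → ℝ) (k : Fin m) :
    HasDerivAt (fun t => Ytf ys τ (Function.update θ k t))
      (Pi.single k (-Complex.I * Ytf ys τ θ k)) (θ k) := by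
  refine hasDerivAt_comp_update (g := fun l s =>
    -ys l * Complex.exp (-(Complex.I * (s : ℂ))) / (τ l : ℂ)) ?_
  have h := ((((Complex.ofRealCLM.hasDerivAt (x := θ k)).const_mul Complex.I).fun_neg.cexp).const_mul
    (-ys k)).div_const (τ k : ℂ)
  refine h.congr_deriv ?_
  simp only [Ytf, Complex.ofRealCLM_apply, Complex.ofReal_one]
  ring

theorem hasDerivAt_Ybus_mulVec_theta {m n : ℕ} (Cf Ct : Matrix (Fin m) (Fin n) ℝ)
    (ys : Fin m → ℂ) (bc : Fin m → ℝ) (Ysh : Fin n → ℂ) (τ θ : Fin m → ℝ) (V : Fin n → ℂ)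
    (k : Fin m) (i : Fin n) :
    HasDerivAt (fun t => (Ybus Cf Ct ys bc Ysh τ (Function.update θ k t)).mulVec V i)
      (cmat Cf k i * (Complex.I * Yft ys τ θ k) * (cmat Ct).mulVec V k
        + cmat Ct k i * (-Complex.I * Ytf ys τ θ k) * (cmat Cf).mulVec V k) (θ k) := by
  simp only [Ybus, add_mulVec, Pi.add_apply, transpose_mul_diagonal_mul_mulVec]
  exact ((((hasDerivAt_sum_mul_mul_single (hasDerivAt_Yft_update ys τ θ k) _ _).const_add _).fun_add
    (hasDerivAt_sum_mul_mul_single (hasDerivAt_Ytf_update ys τ θ k) _ _)).add_const _).add_const _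

/-- G_θ^s = [V]( C_fᵀ[C_t V*][-jY_ft*] + C_tᵀ[C_f V*][jY_tf*] ),
stated entrywise at bus `i` for the partial derivative in the phase shift angle `θ_k`. -/
theorem Sbus_hasDerivAt_theta {m n : ℕ}
    (Cf Ct : Matrix (Fin m) (Fin n) ℝ) (ys : Fin m → ℂ) (bc : Fin m → ℝ)
    (Ysh : Fin n → ℂ) (τ θ : Fin m → ℝ) (hτ : ∀ l, τ l ≠ 0)
    (V : Fin n → ℂ) (k : Fin m) (i : Fin n) :
    HasDerivAt
      (fun t : ℝ => Sbus Cf Ct ys bc Ysh V τ (Function.update θ k t) i)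
      (V i *
        (-Complex.I * (starRingEnd ℂ) (Yft ys τ θ k) * (Cf k i : ℂ)
            * (starRingEnd ℂ) ((cmat Ct).mulVec V k)
          + Complex.I * (starRingEnd ℂ) (Ytf ys τ θ k) * (Ct k i : ℂ)
            * (starRingEnd ℂ) ((cmat Cf).mulVec V k)))
      (θ k) := by
  have h := ((hasDerivAt_Ybus_mulVec_theta Cf Ct ys bc Ysh τ θ V k i).star).const_mul (V i)
  refine h.congr_deriv ?_
  simp only [cmat, map_apply, ← starRingEnd_apply, map_add, map_mul, map_neg, Complex.conj_I,
    Complex.conj_ofReal]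
  ring
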